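/- Fix i ∈ {0,…,n} and let d : ℕ → Fin (n+1) → ℕ be any function such that for every e there is an isomorphism of R-modules ᵉ(M_i) ≅ ⊕_{j=0}^{n} M_j^{⊕ d(e,j)}. Then for every j, the sequence d(e,j)/p^{de} converges as e → ∞, with limit (dim_k V_i)(dim_k V_j)/|G| (equivalently (rank_R M_i)(rank_R M_j)/|G|). -/

import Mathlib

/-!
Generalized F-signature `s(M_i, M_j)`: if `ᵉ(M_i) ≅ ⊕_j M_j^{⊕ d(e,j)}` as `R`-modules
(an additive isomorphism `φ` with `φ (r^{p^e} • x) = r • φ x`), then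
`d(e,j)/p^{de} → (dim_k V_i)(dim_k V_j)/|G|`.  See the header of the setting below.
-/

set_option linter.unusedSectionVars false
set_option synthInstance.maxHeartbeats 1000000
set_option maxHeartbeats 1600000

open MvPolynomial TensorProduct

section Defs

variable (k : Type) [Field k] (d : ℕ) (G : Type) [Group G] [Fintype G]
variable [MulSemiringAction G (MvPolynomial (Fin d) k)]
variable [SMulCommClass G k (MvPolynomial (Fin d) k)]

/-- The invariant subring `R = S^G` as a subalgebra of `S = k[x_1, …, x_d]`. -/
def invariantSubalgebra : Subalgebra k (MvPolynomial (Fin d) k) where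
  carrier := MulAction.fixedPoints G (MvPolynomial (Fin d) k)
  mul_mem' := by
    intro a b ha hb g
    rw [smul_mul', ha g, hb g]
  add_mem' := by
    intro a b ha hb g
    rw [smul_add, ha g, hb g]
  algebraMap_mem' := by
    intro c g
    rw [Algebra.algebraMap_eq_smul_one, smul_comm, smul_one]

variable (W : Type) [AddCommGroup W] [Module k W] [DistribMulAction G W] [SMulCommClass G k W]

/-- The diagonal action of `g ∈ G` on `S ⊗_k W`. -/
noncomputable def diagAction (g : G) :
    (MvPolynomial (Fin d) k ⊗[k] W) →ₗ[k] (MvPolynomial (Fin d) k ⊗[k] W) :=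
  TensorProduct.map (DistribMulAction.toLinearMap k _ g) (DistribMulAction.toLinearMap k W g)

theorem diagAction_smul (g : G) (s : MvPolynomial (Fin d) k) (x : MvPolynomial (Fin d) k ⊗[k] W) :
    diagAction k d G W g (s • x) = (g • s) • diagAction k d G W g x := by
  induction x using TensorProduct.induction_on with
  | zero => simp
  | tmul s' w =>
      simp only [TensorProduct.smul_tmul', diagAction, TensorProduct.map_tmul,
        DistribMulAction.toLinearMap, DistribSMul.toLinearMap_apply, smul_eq_mul, smul_mul']
  | add x y hx hy =>
      simp only [smul_add, map_add, hx, hy]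

/-- `(S ⊗_k W)^G` (invariants of the diagonal action) as a module over `R = S^G`. -/
noncomputable def invariantsTensor : Submodule (invariantSubalgebra k d G)
    (MvPolynomial (Fin d) k ⊗[k] W) where
  carrier := {x | ∀ g : G, diagAction k d G W g x = x}
  add_mem' := by
    intro a b ha hb g
    rw [map_add, ha g, hb g]
  zero_mem' := by intro g; rw [map_zero]
  smul_mem' := by
    intro r x hx g
    have h : (r : MvPolynomial (Fin d) k) • x = r • x := rfl
    rw [← h, diagAction_smul, r.2 g, hx g]

/-- A representation of `G` over `k` is irreducible if it is nonzero and has no nontrivial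
`G`-stable subspaces. -/
def IsIrreducibleRep (M : Type) [AddCommGroup M] [Module k M] [DistribMulAction G M]
    [SMulCommClass G k M] : Prop :=
  Nontrivial M ∧
    ∀ N : Submodule k M, (∀ g : G, ∀ x ∈ N, g • x ∈ N) → N = ⊥ ∨ N = ⊤

/-- Two representations of `G` over `k` are isomorphic if there is a `G`-equivariant
`k`-linear equivalence between them. -/
def IsRepIso (M M' : Type) [AddCommGroup M] [Module k M] [DistribMulAction G M]
    [SMulCommClass G k M] [AddCommGroup M'] [Module k M'] [DistribMulAction G M']
    [SMulCommClass G k M'] : Prop :=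
  ∃ φ : M ≃ₗ[k] M', ∀ (g : G) (x : M), φ (g • x) = g • φ x

end Defs


section PartOne

variable {k : Type} [Field k] {d : ℕ} {G : Type} [Group G] [Fintype G]
variable [MulSemiringAction G (MvPolynomial (Fin d) k)]
variable [SMulCommClass G k (MvPolynomial (Fin d) k)]

theorem aux_smul_C (g : G) (c : k) : g • (C c : MvPolynomial (Fin d) k) = C c := by
  rw [← mul_one (C c), ← MvPolynomial.smul_eq_C_mul, smul_comm, smul_one]

theorem aux_fix_all (g : G) (h : ∀ j : Fin d, g • (X j : MvPolynomial (Fin d) k) = X j)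
    (s : MvPolynomial (Fin d) k) : g • s = s := by
  induction s using MvPolynomial.induction_on with
  | C a => exact aux_smul_C g a
  | add p q hp hq => rw [smul_add, hp, hq]
  | mul_X p j hp => rw [smul_mul', hp, h]

theorem aux_span_totalDegree (s : MvPolynomial (Fin d) k)
    (hs : s ∈ Submodule.span k (Set.range (X : Fin d → MvPolynomial (Fin d) k))) :
    s.totalDegree ≤ 1 := by
  induction hs using Submodule.span_induction with
  | mem x hx => obtain ⟨j, rfl⟩ := hx; exact (totalDegree_X j).le
  | zero => simp
  | add x y _ _ hx hy => exact (totalDegree_add x y).trans (max_le hx hy)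
  | smul a x _ hx => exact (totalDegree_smul_le a x).trans hx

theorem aux_prime_not
    (hlin : ∀ (g : G) (j : Fin d),
      g • (X j : MvPolynomial (Fin d) k) ∈ Submodule.span k (Set.range X))
    (hfaithful : ∀ g : G, (∀ s : MvPolynomial (Fin d) k, g • s = s) → g = 1)
    (hps : ∀ g : G, g ≠ 1 → Module.finrank k
      (Submodule.span k (Set.range fun j : Fin d =>
        g • (X j : MvPolynomial (Fin d) k) - X j)) ≠ 1)
    (π : MvPolynomial (Fin d) k) (hπ : Prime π) (γ : G) (hγ : γ ≠ 1) :
    ∃ s : MvPolynomial (Fin d) k, ¬ π ∣ γ • s - s := by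
  by_contra! hcon
  apply hps γ hγ
  have hdeg : π.totalDegree ≠ 0 := by
    intro h0
    rw [totalDegree_eq_zero_iff_eq_C] at h0
    apply hπ.not_isUnit
    rw [h0]
    apply IsUnit.map
    apply IsUnit.mk0
    intro h
    apply hπ.ne_zero
    rw [h0, h, C_0]
  have hlf : ∀ j : Fin d, ∃ c : k, γ • (X j : MvPolynomial (Fin d) k) - X j = c • π := by
    intro j
    obtain ⟨u, hu⟩ := hcon (X j)
    by_cases hu0 : u = 0
    · exact ⟨0, by rw [hu, hu0]; simp⟩
    have h1 : (γ • (X j : MvPolynomial (Fin d) k) - X j).totalDegree ≤ 1 :=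
      aux_span_totalDegree _ (Submodule.sub_mem _ (hlin γ j)
        (Submodule.subset_span ⟨j, rfl⟩))
    rw [hu, totalDegree_mul_of_isDomain hπ.ne_zero hu0] at h1
    have h2 : u.totalDegree = 0 := by omega
    rw [totalDegree_eq_zero_iff_eq_C] at h2
    refine ⟨coeff 0 u, ?_⟩
    rw [hu, MvPolynomial.smul_eq_C_mul, ← h2, mul_comm]
  have hex : ∃ j : Fin d, γ • (X j : MvPolynomial (Fin d) k) ≠ X j := by
    by_contra! h
    exact hγ (hfaithful γ (aux_fix_all γ h))
  have : Submodule.span k (Set.range fun j : Fin d =>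
        γ • (X j : MvPolynomial (Fin d) k) - X j) = Submodule.span k {π} := by
    apply le_antisymm
    · rw [Submodule.span_le]
      rintro _ ⟨j, rfl⟩
      obtain ⟨c, hc⟩ := hlf j
      simp only [hc]
      exact Submodule.smul_mem _ _ (Submodule.mem_span_singleton_self π)
    · rw [Submodule.span_singleton_le_iff_mem]
      obtain ⟨j, hj⟩ := hex
      obtain ⟨c, hc⟩ := hlf j
      have hc0 : c ≠ 0 := by
        rintro rfl
        rw [zero_smul, sub_eq_zero] at hc
        exact hj hc
      have : π = c⁻¹ • (γ • (X j : MvPolynomial (Fin d) k) - X j) := by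
        rw [hc, smul_smul, inv_mul_cancel₀ hc0, one_smul]
      rw [this]
      exact Submodule.smul_mem _ _ (Submodule.subset_span ⟨j, rfl⟩)
  rw [this]
  exact finrank_span_singleton hπ.ne_zero

theorem aux_dedekind (p : ℕ) [Fact p.Prime] [CharP k p] {K : Type} [CommRing K] [IsDomain K]
    (f : MvPolynomial (Fin d) k →+* K) (hf : ∀ γ : G, γ ≠ 1 → ∃ s, f (γ • s - s) ≠ 0)
    (e : ℕ) (B : G → K) (hB : ∀ s, ∑ g, B g * f (g • s) ^ p ^ e = 0) (g : G) : B g = 0 := by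
  have : CharP K p := by
    have := (f.comp (C : k →+* MvPolynomial (Fin d) k)).charP_iff
      (f.comp (C : k →+* MvPolynomial (Fin d) k)).injective p
    exact this.1 inferInstance
  let χ : G → (MvPolynomial (Fin d) k →* K) := fun g =>
    { toFun := fun s => f (g • s) ^ p ^ e
      map_one' := by simp
      map_mul' := by intro x y; rw [smul_mul', map_mul, mul_pow] }
  have hinj : Function.Injective χ := by
    intro g h hgh
    by_contra hne
    have h1 : g * h⁻¹ ≠ 1 := by rwa [Ne, mul_inv_eq_one]
    obtain ⟨s, hs⟩ := hf _ h1
    apply hs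
    have := DFunLike.congr_fun hgh (h⁻¹ • s)
    change f (g • h⁻¹ • s) ^ p ^ e = f (h • h⁻¹ • s) ^ p ^ e at this
    rw [smul_inv_smul, ← sub_eq_zero, ← sub_pow_char_pow] at this
    rw [map_sub, mul_smul]
    exact eq_zero_of_pow_eq_zero this
  have hli := (linearIndependent_monoidHom (MvPolynomial (Fin d) k) K).comp χ hinj
  rw [Fintype.linearIndependent_iff] at hli
  refine hli B ?_ g
  ext s
  simpa [χ] using hB s

theorem aux_denom (p : ℕ) [Fact p.Prime] [CharP k p]
    (hpr : ∀ π : MvPolynomial (Fin d) k, Prime π → ∀ γ : G, γ ≠ 1 →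
      ∃ s : MvPolynomial (Fin d) k, ¬ π ∣ γ • s - s)
    (e : ℕ) (D : MvPolynomial (Fin d) k) (hD : D ≠ 0) (B : G → MvPolynomial (Fin d) k)
    (hB : ∀ s : MvPolynomial (Fin d) k, D ∣ ∑ g, B g * (g • s) ^ p ^ e) (g : G) : D ∣ B g := by
  induction D using UniqueFactorizationMonoid.induction_on_prime generalizing B with
  | h₁ => exact absurd rfl hD
  | h₂ x hx => exact hx.dvd
  | h₃ a π ha hπ ih =>
    have h1 : ∀ g, π ∣ B g := by
      intro g
      have : (Ideal.span {π}).IsPrime := (Ideal.span_singleton_prime hπ.ne_zero).2 hπ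
      rw [← Ideal.mem_span_singleton, ← Ideal.Quotient.eq_zero_iff_mem]
      refine aux_dedekind p (Ideal.Quotient.mk (Ideal.span {π})) ?_ e
        (fun g => Ideal.Quotient.mk (Ideal.span {π}) (B g)) ?_ g
      · intro γ hγ
        obtain ⟨s, hs⟩ := hpr π hπ γ hγ
        refine ⟨s, ?_⟩
        rwa [Ne, Ideal.Quotient.eq_zero_iff_mem, Ideal.mem_span_singleton]
      · intro s
        have := (dvd_mul_right π a).trans (hB s)
        rw [← Ideal.mem_span_singleton, ← Ideal.Quotient.eq_zero_iff_mem] at this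
        simpa using this
    choose B' hB' using h1
    rw [hB' g]
    apply mul_dvd_mul_left
    apply ih ha
    intro s
    have := hB s
    simp only [hB', mul_assoc, ← Finset.mul_sum] at this
    exact (mul_dvd_mul_iff_left hπ.ne_zero).1 this

end PartOne



section PartTwo

variable {k : Type} [Field k] {d : ℕ} {G : Type} [Group G] [Fintype G]
variable [MulSemiringAction G (MvPolynomial (Fin d) k)]
variable [SMulCommClass G k (MvPolynomial (Fin d) k)]

theorem aux_dual (p : ℕ) [Fact p.Prime] [CharP k p] [DecidableEq G]
    (hfaithful : ∀ g : G, (∀ s : MvPolynomial (Fin d) k, g • s = s) → g = 1) :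
    ∃ (t t' : G → MvPolynomial (Fin d) k) (c : MvPolynomial (Fin d) k), c ≠ 0 ∧
      ∀ g : G, ∑ i, t i * (g • t' i) = if g = 1 then c else 0 := by
  let S := MvPolynomial (Fin d) k
  let K := FractionRing S
  have hinjK : Function.Injective (algebraMap S K) := IsFractionRing.injective S K
  let v : S → (G → K) := fun s g => algebraMap S K (g • s)
  have hspan : Submodule.span K (Set.range v) = ⊤ := by
    by_contra hne
    obtain ⟨f, hf0, hf⟩ := Submodule.exists_le_ker_of_lt_top _ (lt_top_iff_ne_top.2 hne)
    apply hf0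
    have key : ∀ g, f (Pi.single g 1) = 0 := by
      refine aux_dedekind p (algebraMap S K) ?_ 0 (fun g => f (Pi.single g 1)) ?_
      · intro γ hγ
        by_contra! h
        apply hγ
        apply hfaithful
        intro s
        have := h s
        rw [← map_zero (algebraMap S K)] at this
        exact sub_eq_zero.1 (hinjK this)
      · intro s
        have h1 : f (v s) = 0 := hf (Submodule.subset_span ⟨s, rfl⟩)
        rw [LinearMap.pi_apply_eq_sum_univ f (v s)] at h1
        simp only [pow_zero, pow_one]
        rw [← h1]
        refine Finset.sum_congr rfl fun g _ => ?_
        rw [smul_eq_mul, mul_comm]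
        congr 2
        ext j
        simp [Pi.single_apply, eq_comm]
    apply LinearMap.pi_ext'
    intro g
    ext
    simpa using key g
  obtain ⟨b, hb, hbs, hbl⟩ := exists_linearIndependent K (Set.range v)
  let bas : Module.Basis b K (G → K) := Module.Basis.mk hbl (by
    rw [Subtype.range_coe, hbs, hspan])
  have : Finite b := Module.Finite.finite_basis bas
  have : Fintype b := Fintype.ofFinite b
  have hcard : Fintype.card b = Fintype.card G := by
    rw [← Module.finrank_eq_card_basis bas, Module.finrank_fintype_fun_eq_card]
  let eqv : b ≃ G := Fintype.equivOfCardEq hcard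
  have hch : ∀ i : G, ∃ s : S, v s = (eqv.symm i : G → K) := fun i => hb (eqv.symm i).2
  choose t' ht' using hch
  let A : Matrix G G S := Matrix.of fun i g => g • t' i
  have hli : LinearIndependent K (A.map (algebraMap S K)).row := by
    have := hbl.comp eqv.symm eqv.symm.injective
    have h2 : (A.map (algebraMap S K)).row = (Subtype.val ∘ eqv.symm : G → (G → K)) := by
      ext i g
      have := congrFun (ht' i) g
      simpa [A, v, Matrix.row] using this
    rw [h2]
    exact this
  have hdet : A.det ≠ 0 := by
    have h1 := (Matrix.linearIndependent_rows_iff_isUnit).1 hli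
    rw [Matrix.isUnit_iff_isUnit_det] at h1
    intro h
    have h2 := RingHom.map_det (algebraMap S K) A
    rw [h, map_zero] at h2
    apply h1.ne_zero
    rw [h2]; rfl
  refine ⟨fun i => A.adjugate 1 i, t', A.det, hdet, ?_⟩
  intro g
  have := congrFun (congrFun A.adjugate_mul 1) g
  rw [Matrix.mul_apply] at this
  simpa [A, Matrix.one_apply, eq_comm] using this

theorem aux_semilinear (p : ℕ) [Fact p.Prime] [CharP k p]
    (hfaithful : ∀ g : G, (∀ s : MvPolynomial (Fin d) k, g • s = s) → g = 1)
    (hpr : ∀ π : MvPolynomial (Fin d) k, Prime π → ∀ γ : G, γ ≠ 1 →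
      ∃ s : MvPolynomial (Fin d) k, ¬ π ∣ γ • s - s)
    (e : ℕ) (f : MvPolynomial (Fin d) k →+ MvPolynomial (Fin d) k)
    (hf : ∀ r s, (∀ g : G, g • r = r) → f (r * s) = r ^ p ^ e * f s) :
    ∃ a : G → MvPolynomial (Fin d) k, ∀ s, f s = ∑ g, a g * (g • s) ^ p ^ e := by
  classical
  obtain ⟨t, t', c, hc, htt⟩ := aux_dual p hfaithful
  have hcs : ∀ s, c * s = ∑ i, (∑ g : G, g • (t' i * s)) * t i := by
    intro s
    simp only [Finset.sum_mul]
    rw [Finset.sum_comm]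
    have : ∀ g : G, ∑ i, g • (t' i * s) * t i = (if g = 1 then c else 0) * (g • s) := by
      intro g
      rw [← htt g, Finset.sum_mul]
      refine Finset.sum_congr rfl fun i _ => ?_
      rw [smul_mul']; ring
    simp only [this]
    simp
  have hinv : ∀ (x : MvPolynomial (Fin d) k) (h : G), h • ∑ g : G, g • x = ∑ g : G, g • x := by
    intro x h
    rw [Finset.smul_sum]
    simp only [smul_smul]
    exact Equiv.sum_comp (Equiv.mulLeft h) (fun g => g • x)
  have hfc : ∀ s, f (c * s) = ∑ g : G, (∑ i, (g • t' i) ^ p ^ e * f (t i)) * (g • s) ^ p ^ e := by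
    intro s
    rw [hcs, map_sum]
    simp only [hf _ _ (hinv _)]
    simp only [sum_pow_char_pow, Finset.sum_mul]
    rw [Finset.sum_comm]
    refine Finset.sum_congr rfl fun g _ => Finset.sum_congr rfl fun i _ => ?_
    rw [smul_mul', mul_pow]; ring
  let Cn : MvPolynomial (Fin d) k := ∏ g : G, g • c
  have hCn0 : Cn ≠ 0 := by
    rw [Finset.prod_ne_zero_iff]
    intro g _
    rwa [Ne, smul_eq_zero_iff_eq]
  have hCninv : ∀ h : G, h • Cn = Cn := by
    intro h
    simp only [Cn, Finset.smul_prod', smul_smul]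
    exact Equiv.prod_comp (Equiv.mulLeft h) (fun g => g • c)
  obtain ⟨c2, hc2⟩ : c ∣ Cn := by
    have := Finset.dvd_prod_of_mem (fun g : G => g • c) (Finset.mem_univ 1)
    simpa using this
  let Bg : G → MvPolynomial (Fin d) k := fun g =>
    (∑ i, (g • t' i) ^ p ^ e * f (t i)) * (g • c2) ^ p ^ e
  have hBg : ∀ s, Cn ^ p ^ e * f s = ∑ g, Bg g * (g • s) ^ p ^ e := by
    intro s
    rw [← hf _ _ hCninv, hc2, mul_assoc, hfc]
    refine Finset.sum_congr rfl fun g _ => ?_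
    rw [smul_mul', mul_pow, ← mul_assoc]
  have hdv := aux_denom p hpr e (Cn ^ p ^ e) (pow_ne_zero _ hCn0) Bg
    (fun s => ⟨f s, (hBg s).symm⟩)
  choose a ha using hdv
  refine ⟨a, fun s => ?_⟩
  have := hBg s
  simp only [ha, mul_assoc, ← Finset.mul_sum] at this
  exact mul_left_cancel₀ (pow_ne_zero _ hCn0) this

theorem aux_frobIdeal (q : ℕ) (f : MvPolynomial (Fin d) k) :
    (∃ y : Fin d → MvPolynomial (Fin d) k, f = ∑ l, X l ^ q * y l) ↔
      ∀ b : Fin d →₀ ℕ, (∀ l, b l < q) → coeff b f = 0 := by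
  have h1 : (∃ y : Fin d → MvPolynomial (Fin d) k, f = ∑ l, X l ^ q * y l) ↔
      f ∈ Ideal.span ((fun s => monomial s (1 : k)) '' (Set.range fun l : Fin d =>
        Finsupp.single l q)) := by
    rw [← Set.range_comp, Ideal.span, Submodule.mem_span_range_iff_exists_fun]
    refine exists_congr fun y => ?_
    rw [eq_comm]
    simp [X_pow_eq_monomial, mul_comm]
  rw [h1, mem_ideal_span_monomial_image]
  constructor
  · intro h b hb
    by_contra hne
    obtain ⟨_, ⟨l, rfl⟩, hl⟩ := h b (mem_support_iff.2 hne)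
    have := hl l
    simp at this
    exact absurd (hb l) (not_lt.2 this)
  · intro h b hb
    by_contra! hcon
    apply mem_support_iff.1 hb
    apply h
    intro l
    by_contra! hl
    exact hcon _ ⟨l, rfl⟩ (by simpa using hl)

theorem aux_lead (c : MvPolynomial (Fin d) k) (hc : c ≠ 0) :
    ∃ a : Fin d → ℕ, ∀ (q : ℕ) (u : MvPolynomial (Fin d) k),
      (∀ b ∈ u.support, ∀ l, b l < q - a l) →
      (∀ b : Fin d →₀ ℕ, (∀ l, b l < q) → coeff b (c * u) = 0) → u = 0 := by
  let m : MonomialOrder (Fin d) := MonomialOrder.lex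
  refine ⟨m.degree c, ?_⟩
  intro q u hu hcu
  by_contra hu0
  have h1 := hcu (m.degree (c * u)) (by
    intro l
    rw [MonomialOrder.degree_mul hc hu0]
    have := hu (m.degree u) (mem_support_iff.2 (MonomialOrder.coeff_degree_ne_zero_iff.2 hu0)) l
    rw [Finsupp.add_apply]
    omega)
  exact MonomialOrder.coeff_degree_ne_zero_iff.2 (mul_ne_zero hc hu0) h1

end PartTwo



section PartThree

variable {k : Type} [Field k] {d : ℕ} {G : Type} [Group G] [Fintype G]
variable [MulSemiringAction G (MvPolynomial (Fin d) k)]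
variable [SMulCommClass G k (MvPolynomial (Fin d) k)]
variable {U : Type} [AddCommGroup U] [Module k U] [DistribMulAction G U] [SMulCommClass G k U]

theorem diag_tmul (g : G) (s : MvPolynomial (Fin d) k) (u : U) :
    diagAction k d G U g (s ⊗ₜ[k] u) = (g • s) ⊗ₜ[k] (g • u) := rfl

theorem diag_one (x : MvPolynomial (Fin d) k ⊗[k] U) : diagAction k d G U 1 x = x := by
  induction x using TensorProduct.induction_on with
  | zero => simp
  | tmul s u => rw [diag_tmul, one_smul, one_smul]
  | add x y hx hy => rw [map_add, hx, hy]

theorem diag_mul (g h : G) (x : MvPolynomial (Fin d) k ⊗[k] U) :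
    diagAction k d G U (g * h) x = diagAction k d G U g (diagAction k d G U h x) := by
  induction x using TensorProduct.induction_on with
  | zero => simp
  | tmul s u => simp only [diag_tmul, mul_smul]
  | add x y hx hy => simp only [map_add, hx, hy]

theorem diag_sum_inv (x : MvPolynomial (Fin d) k ⊗[k] U) (h : G) :
    diagAction k d G U h (∑ g : G, diagAction k d G U g x) = ∑ g : G, diagAction k d G U g x := by
  rw [map_sum]
  simp only [← diag_mul]
  exact Equiv.sum_comp (Equiv.mulLeft h) (fun g => diagAction k d G U g x)

variable (G) in
/-- The transfer map from `S ⊗ U` to its invariants. -/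
noncomputable def trT : (MvPolynomial (Fin d) k ⊗[k] U) →+ invariantsTensor k d G U where
  toFun x := ⟨∑ g : G, diagAction k d G U g x, diag_sum_inv x⟩
  map_zero' := by ext; simp
  map_add' x y := by ext; simp [Finset.sum_add_distrib]

theorem trT_coe (x : MvPolynomial (Fin d) k ⊗[k] U) :
    (trT G x : MvPolynomial (Fin d) k ⊗[k] U) = ∑ g : G, diagAction k d G U g x := rfl

theorem trT_diag (h : G) (x : MvPolynomial (Fin d) k ⊗[k] U) :
    trT G (diagAction k d G U h x) = trT G x := by
  ext
  rw [trT_coe, trT_coe]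
  simp only [← diag_mul]
  exact Equiv.sum_comp (Equiv.mulRight h) (fun g => diagAction k d G U g x)

theorem trT_smul (r : invariantSubalgebra k d G) (x : MvPolynomial (Fin d) k ⊗[k] U) :
    trT G ((r : MvPolynomial (Fin d) k) • x) = r • trT G x := by
  ext
  rw [Submodule.coe_smul, trT_coe, trT_coe, Finset.smul_sum]
  refine Finset.sum_congr rfl fun g _ => ?_
  rw [diagAction_smul, r.2 g]
  rfl

variable [Module.Finite k U]

variable (k d U) in
/-- A basis of `S ⊗ U` over `S`. -/
noncomputable def bN : Module.Basis (Fin (Module.finrank k U)) (MvPolynomial (Fin d) k)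
    (MvPolynomial (Fin d) k ⊗[k] U) :=
  (Module.finBasis k U).baseChange (MvPolynomial (Fin d) k)

theorem bN_ext (x y : MvPolynomial (Fin d) k ⊗[k] U)
    (h : ∀ u, (bN k d U).coord u x = (bN k d U).coord u y) : x = y :=
  (bN k d U).ext_elem h

theorem aux_uniq (p : ℕ) [Fact p.Prime] [CharP k p]
    (hfaithful : ∀ g : G, (∀ s : MvPolynomial (Fin d) k, g • s = s) → g = 1) (e : ℕ)
    (A : G → MvPolynomial (Fin d) k ⊗[k] U)
    (hA : ∀ s : MvPolynomial (Fin d) k, ∑ g, (g • s) ^ p ^ e • A g = 0) (g : G) : A g = 0 := by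
  apply bN_ext
  intro u
  rw [map_zero]
  refine aux_dedekind p (RingHom.id (MvPolynomial (Fin d) k)) ?_ e
    (fun g => (bN k d U).coord u (A g)) ?_ g
  · intro γ hγ
    by_contra! h
    exact hγ (hfaithful γ fun s => sub_eq_zero.1 (h s))
  · intro s
    have := congrArg ((bN k d U).coord u) (hA s)
    rw [map_sum, map_zero] at this
    rw [← this]
    refine Finset.sum_congr rfl fun g _ => ?_
    rw [((bN k d U).coord u).map_smul, smul_eq_mul, mul_comm]
    rfl

theorem aux_tr_uniq (p : ℕ) [Fact p.Prime] [CharP k p]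
    (hfaithful : ∀ g : G, (∀ s : MvPolynomial (Fin d) k, g • s = s) → g = 1) (e : ℕ)
    (a b : MvPolynomial (Fin d) k ⊗[k] U)
    (h : ∀ s : MvPolynomial (Fin d) k, trT G (s ^ p ^ e • a) = trT G (s ^ p ^ e • b)) :
    a = b := by
  have := aux_uniq p hfaithful e (fun g => diagAction k d G U g (a - b)) (by
    intro s
    have h1 : trT G (s ^ p ^ e • (a - b)) = 0 := by
      rw [smul_sub, map_sub, h, sub_self]
    have h2 := congrArg Subtype.val h1
    rw [trT_coe] at h2
    simpa only [diagAction_smul, smul_pow', ZeroMemClass.coe_zero] using h2) 1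
  simp only [diag_one] at this
  exact sub_eq_zero.1 this

theorem aux_tr_exists (p : ℕ) [Fact p.Prime] [CharP k p]
    (hfaithful : ∀ g : G, (∀ s : MvPolynomial (Fin d) k, g • s = s) → g = 1)
    (hpr : ∀ π : MvPolynomial (Fin d) k, Prime π → ∀ γ : G, γ ≠ 1 →
      ∃ s : MvPolynomial (Fin d) k, ¬ π ∣ γ • s - s)
    (e : ℕ) (f : MvPolynomial (Fin d) k →+ invariantsTensor k d G U)
    (hf : ∀ (r : invariantSubalgebra k d G) s, f (r * s) = r ^ p ^ e • f s) :
    ∃ a : MvPolynomial (Fin d) k ⊗[k] U, ∀ s, f s = trT G (s ^ p ^ e • a) := by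
  have h1 : ∀ u, ∃ a : G → MvPolynomial (Fin d) k, ∀ s,
      (bN k d U).coord u (f s : MvPolynomial (Fin d) k ⊗[k] U) =
        ∑ g, a g * (g • s) ^ p ^ e := by
    intro u
    refine aux_semilinear p hfaithful hpr e
      (((bN k d U).coord u).toAddMonoidHom.comp
        ((invariantsTensor k d G U).subtype.toAddMonoidHom.comp f)) ?_
    intro r s hr
    have := hf ⟨r, hr⟩ s
    have h2 : ((f (r * s) : invariantsTensor k d G U) : MvPolynomial (Fin d) k ⊗[k] U) =
        r ^ p ^ e • (f s : MvPolynomial (Fin d) k ⊗[k] U) := by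
      rw [this]; rfl
    change (bN k d U).coord u (f (r * s) : MvPolynomial (Fin d) k ⊗[k] U) =
      r ^ p ^ e * (bN k d U).coord u (f s : MvPolynomial (Fin d) k ⊗[k] U)
    rw [h2, map_smul, smul_eq_mul]
  choose a ha using h1
  let A : G → MvPolynomial (Fin d) k ⊗[k] U := fun g => (bN k d U).equivFun.symm fun u => a u g
  have hA : ∀ s, (f s : MvPolynomial (Fin d) k ⊗[k] U) = ∑ g, (g • s) ^ p ^ e • A g := by
    intro s
    apply bN_ext
    intro u
    rw [ha, map_sum]
    refine Finset.sum_congr rfl fun g _ => ?_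
    rw [map_smul, smul_eq_mul, mul_comm]
    congr 1
    have := congrFun ((bN k d U).equivFun.apply_symm_apply fun u => a u g) u
    exact this.symm
  have hAg : ∀ h : G, A h = diagAction k d G U h (A 1) := by
    intro h
    have := aux_uniq p hfaithful e (fun g => A g - diagAction k d G U h (A (h⁻¹ * g))) (by
      intro s
      have h2 := (f s).2 h
      rw [hA, map_sum] at h2
      simp only [smul_sub, Finset.sum_sub_distrib]
      rw [sub_eq_zero, ← h2]
      simp only [diagAction_smul, smul_pow', smul_smul]
      rw [← Equiv.sum_comp (Equiv.mulLeft h)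
        (fun x => (x • s) ^ p ^ e • diagAction k d G U h (A (h⁻¹ * x)))]
      simp) h
    simpa [sub_eq_zero] using this
  refine ⟨A 1, fun s => ?_⟩
  ext
  rw [hA, trT_coe]
  refine Finset.sum_congr rfl fun g _ => ?_
  rw [diagAction_smul, smul_pow', ← hAg]


end PartThree



section PartFour

variable {k : Type} [Field k] {d : ℕ}

section evz
variable (k d) (U : Type) [AddCommGroup U] [Module k U]

/-- Reduction of `S ⊗ U` modulo the irrelevant ideal. -/
noncomputable def evz : (MvPolynomial (Fin d) k ⊗[k] U) →ₗ[k] U :=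
  TensorProduct.lift ((LinearMap.lsmul k U).comp
    (MvPolynomial.lcoeff k (0 : Fin d →₀ ℕ)))

variable {k d U}

theorem evz_tmul (s : MvPolynomial (Fin d) k) (u : U) :
    evz k d U (s ⊗ₜ[k] u) = coeff 0 s • u := by
  simp [evz]

theorem evz_smul (s : MvPolynomial (Fin d) k) (x : MvPolynomial (Fin d) k ⊗[k] U) :
    evz k d U (s • x) = coeff 0 s • evz k d U x := by
  induction x using TensorProduct.induction_on with
  | zero => simp
  | tmul s' u =>
    rw [TensorProduct.smul_tmul', evz_tmul, evz_tmul, smul_eq_mul, smul_smul]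
    congr 1
    simp [← MvPolynomial.constantCoeff_eq]
  | add x y hx hy => simp only [smul_add, map_add, hx, hy]

theorem evz_decomp (x : MvPolynomial (Fin d) k ⊗[k] U) :
    ∃ y : Fin d → MvPolynomial (Fin d) k ⊗[k] U,
      x = 1 ⊗ₜ[k] evz k d U x + ∑ l, (X l : MvPolynomial (Fin d) k) • y l := by
  induction x using TensorProduct.induction_on with
  | zero => exact ⟨0, by simp⟩
  | tmul s u =>
    obtain ⟨y, hy⟩ := (aux_frobIdeal 1 (s - C (coeff 0 s))).2 (by
      intro b hb
      have : b = 0 := by ext l; simpa using hb l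
      rw [this]; simp)
    refine ⟨fun l => y l ⊗ₜ[k] u, ?_⟩
    rw [evz_tmul]
    simp only [TensorProduct.smul_tmul', smul_eq_mul]
    rw [← TensorProduct.sum_tmul, TensorProduct.tmul_smul, TensorProduct.smul_tmul',
      ← TensorProduct.add_tmul]
    congr 1
    simp only [pow_one] at hy
    rw [← hy, MvPolynomial.smul_eq_C_mul]
    ring
  | add x y hx hy =>
    obtain ⟨a, ha⟩ := hx
    obtain ⟨b, hb⟩ := hy
    refine ⟨a + b, ?_⟩
    rw [map_add, TensorProduct.tmul_add]
    simp only [Pi.add_apply, smul_add, Finset.sum_add_distrib]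
    conv_lhs => rw [ha, hb]
    abel

theorem evz_eq_zero (x : MvPolynomial (Fin d) k ⊗[k] U) :
    evz k d U x = 0 ↔ ∃ y : Fin d → MvPolynomial (Fin d) k ⊗[k] U,
      x = ∑ l, (X l : MvPolynomial (Fin d) k) • y l := by
  constructor
  · intro h
    obtain ⟨y, hy⟩ := evz_decomp x
    rw [h] at hy
    exact ⟨y, by simpa using hy⟩
  · rintro ⟨y, rfl⟩
    rw [map_sum]
    refine Finset.sum_eq_zero fun l _ => ?_
    rw [evz_smul]
    simp

end evz

variable {G : Type} [Group G] [Fintype G]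
variable [MulSemiringAction G (MvPolynomial (Fin d) k)]
variable [SMulCommClass G k (MvPolynomial (Fin d) k)]
variable {U : Type} [AddCommGroup U] [Module k U] [DistribMulAction G U] [SMulCommClass G k U]

theorem coeff_zero_smul
    (hlin : ∀ (g : G) (j : Fin d),
      g • (X j : MvPolynomial (Fin d) k) ∈ Submodule.span k (Set.range X))
    (g : G) (s : MvPolynomial (Fin d) k) : coeff 0 (g • s) = coeff 0 s := by
  have hX : ∀ x ∈ Submodule.span k (Set.range (X : Fin d → MvPolynomial (Fin d) k)),
      constantCoeff x = 0 := by
    intro x hx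
    induction hx using Submodule.span_induction with
    | mem x hx => obtain ⟨j, rfl⟩ := hx; simp
    | zero => simp
    | add x y _ _ hx hy => rw [map_add, hx, hy, add_zero]
    | smul a x _ hx => simp [MvPolynomial.smul_eq_C_mul, hx]
  simp only [← MvPolynomial.constantCoeff_eq]
  induction s using MvPolynomial.induction_on with
  | C a => rw [aux_smul_C]
  | add p q hp hq => rw [smul_add, map_add, hp, hq, map_add]
  | mul_X p j hp => rw [smul_mul', map_mul, map_mul, hX _ (hlin g j)]; simp

theorem evz_diag
    (hlin : ∀ (g : G) (j : Fin d),
      g • (X j : MvPolynomial (Fin d) k) ∈ Submodule.span k (Set.range X))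
    (g : G) (x : MvPolynomial (Fin d) k ⊗[k] U) :
    evz k d U (diagAction k d G U g x) = g • evz k d U x := by
  induction x using TensorProduct.induction_on with
  | zero => simp
  | tmul s u => rw [diag_tmul, evz_tmul, evz_tmul, coeff_zero_smul hlin, smul_comm g]
  | add x y hx hy => simp only [map_add, smul_add, hx, hy]

variable [Module.Finite k U]

theorem inM_iff (q : ℕ) (x : MvPolynomial (Fin d) k ⊗[k] U) :
    (∃ y : Fin d → MvPolynomial (Fin d) k ⊗[k] U,
      x = ∑ l, (X l : MvPolynomial (Fin d) k) ^ q • y l) ↔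
    ∀ u, ∀ b : Fin d →₀ ℕ, (∀ l, b l < q) → coeff b ((bN k d U).coord u x) = 0 := by
  constructor
  · rintro ⟨y, rfl⟩ u
    refine (aux_frobIdeal q _).1 ⟨fun l => (bN k d U).coord u (y l), ?_⟩
    rw [map_sum]
    simp only [map_smul, smul_eq_mul]
  · intro h
    have h1 := fun u => (aux_frobIdeal q _).2 (h u)
    choose y hy using h1
    refine ⟨fun l => (bN k d U).equivFun.symm fun u => y u l, ?_⟩
    apply bN_ext
    intro u
    rw [hy, map_sum]
    refine Finset.sum_congr rfl fun l _ => ?_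
    rw [map_smul, smul_eq_mul]
    congr 1
    exact (congrFun ((bN k d U).equivFun.apply_symm_apply fun u => y u l) u).symm

theorem aux_psi (p : ℕ) [Fact p.Prime] [CharP k p]
    (hfaithful : ∀ g : G, (∀ s : MvPolynomial (Fin d) k, g • s = s) → g = 1)
    (hpr : ∀ π : MvPolynomial (Fin d) k, Prime π → ∀ γ : G, γ ≠ 1 →
      ∃ s : MvPolynomial (Fin d) k, ¬ π ∣ γ • s - s)
    {ι : Type} (W : ι → Type) [∀ i, AddCommGroup (W i)] [∀ i, Module k (W i)]
    [∀ i, DistribMulAction G (W i)] [∀ i, SMulCommClass G k (W i)]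
    [∀ i, Module.Finite k (W i)] (m : ι → ℕ) (e : ℕ)
    (φ : invariantsTensor k d G U ≃+ (∀ j, Fin (m j) → invariantsTensor k d G (W j)))
    (hφ : ∀ (r : invariantSubalgebra k d G) (x : invariantsTensor k d G U),
        φ (r ^ p ^ e • x) = r • φ x) :
    ∃ ψ : (MvPolynomial (Fin d) k ⊗[k] U) ≃+
        (∀ j, Fin (m j) → MvPolynomial (Fin d) k ⊗[k] (W j)),
      (∀ (s : MvPolynomial (Fin d) k) a, ψ (s ^ p ^ e • a) = s • ψ a) ∧
      (∀ (g : G) a j t, ψ (diagAction k d G U g a) j t = diagAction k d G (W j) g (ψ a j t)) := by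
  have hex1 : ∀ a : MvPolynomial (Fin d) k ⊗[k] U,
      ∃ b : ∀ j, Fin (m j) → MvPolynomial (Fin d) k ⊗[k] (W j),
        ∀ s : MvPolynomial (Fin d) k, φ (trT G (s ^ p ^ e • a)) =
          fun j t => trT G (s • b j t) := by
    intro a
    have : ∀ j t, ∃ b : MvPolynomial (Fin d) k ⊗[k] (W j), ∀ s : MvPolynomial (Fin d) k,
        φ (trT G (s ^ p ^ e • a)) j t = trT G (s ^ p ^ 0 • b) := by
      intro j t
      refine aux_tr_exists p hfaithful hpr 0
        { toFun := fun s => φ (trT G (s ^ p ^ e • a)) j t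
          map_zero' := by
            have : (0 : MvPolynomial (Fin d) k) ^ p ^ e = 0 :=
              zero_pow (pow_ne_zero _ (Fact.out : p.Prime).ne_zero)
            simp [this]
          map_add' := by
            intro x y
            simp only [add_pow_char_pow, add_smul, map_add, Pi.add_apply] } ?_
      intro r s
      change φ (trT G (((r : MvPolynomial (Fin d) k) * s) ^ p ^ e • a)) j t = _
      have h1 : ((r : MvPolynomial (Fin d) k) * s) ^ p ^ e • a =
          ((r ^ p ^ e : invariantSubalgebra k d G) : MvPolynomial (Fin d) k) • s ^ p ^ e • a := by
        rw [mul_pow, smul_smul]; rfl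
      rw [h1, trT_smul, hφ, pow_zero, pow_one]
      rfl
    choose b hb using this
    refine ⟨b, fun s => ?_⟩
    ext1 j
    ext1 t
    rw [hb j t s, pow_zero, pow_one]
  have hφ' : ∀ (r : invariantSubalgebra k d G) y, φ.symm (r • y) = r ^ p ^ e • φ.symm y := by
    intro r y
    apply φ.injective
    rw [hφ, φ.apply_symm_apply, φ.apply_symm_apply]
  have hex2 : ∀ b : (∀ j, Fin (m j) → MvPolynomial (Fin d) k ⊗[k] (W j)),
      ∃ a : MvPolynomial (Fin d) k ⊗[k] U,
        ∀ s : MvPolynomial (Fin d) k, φ.symm (fun j t => trT G (s • b j t)) =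
          trT G (s ^ p ^ e • a) := by
    intro b
    refine aux_tr_exists p hfaithful hpr e
        { toFun := fun s => φ.symm (fun j t => trT G (s • b j t))
          map_zero' := by
            rw [← map_zero φ.symm]
            congr 1
            ext1 j
            ext1 t
            simp
          map_add' := by
            intro x y
            rw [← map_add φ.symm]
            congr 1
            ext1 j
            ext1 t
            simp [add_smul] } ?_
    intro r s
    change φ.symm (fun j t => trT G (((r : MvPolynomial (Fin d) k) * s) • b j t)) = _
    simp only [mul_smul, trT_smul]
    exact hφ' r _
  choose ψ hψ using hex1
  choose ψ' hψ' using hex2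
  have uq := fun j => aux_tr_uniq (G := G) (U := W j) (d := d) p hfaithful 0
  simp only [pow_zero, pow_one] at uq
  -- uniqueness on the target
  have uq2 : ∀ b b' : (∀ j, Fin (m j) → MvPolynomial (Fin d) k ⊗[k] (W j)),
      (∀ s : MvPolynomial (Fin d) k, (fun j t => trT G (s • b j t) :
        (∀ j, Fin (m j) → invariantsTensor k d G (W j))) = fun j t => trT G (s • b' j t)) →
      b = b' := by
    intro b b' h
    ext1 j
    ext1 t
    apply uq
    intro s
    exact congrFun (congrFun (h s) j) t
  refine ⟨{ toFun := ψ, invFun := ψ', left_inv := ?_, right_inv := ?_, map_add' := ?_ }, ?_, ?_⟩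
  · intro a
    apply aux_tr_uniq p hfaithful e
    intro s
    rw [← hψ', ← hψ, φ.symm_apply_apply]
  · intro b
    apply uq2
    intro s
    rw [← hψ, ← hψ', φ.apply_symm_apply]
  · intro x y
    apply uq2
    intro s
    rw [← hψ, smul_add, map_add, map_add, hψ, hψ]
    ext1 j
    ext1 t
    simp
  · intro s a
    apply uq2
    intro s'
    change (fun j t => trT G (s' • ψ (s ^ p ^ e • a) j t)) = fun j t => trT G (s' • s • ψ a j t)
    simp only [smul_smul]
    rw [← hψ, smul_smul, ← mul_pow, hψ]
  · intro g a j t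
    have : ψ (diagAction k d G U g a) = fun j t => diagAction k d G (W j) g (ψ a j t) := by
      apply uq2
      intro s
      rw [← hψ]
      have h1 : ∀ j t, trT G (s • diagAction k d G (W j) g (ψ a j t)) =
          trT G ((g⁻¹ • s) • ψ a j t) := by
        intro j t
        rw [← trT_diag g ((g⁻¹ • s) • ψ a j t), diagAction_smul, smul_inv_smul]
      simp only [h1]
      rw [← hψ]
      congr 1
      rw [← trT_diag g ((g⁻¹ • s) ^ p ^ e • a), diagAction_smul, smul_pow', smul_inv_smul]
    exact congrFun (congrFun this j) t

end PartFour



section PartFive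

variable {k : Type} [Field k] {G : Type} [Group G] [Fintype G]

theorem irr_finite (U : Type) [AddCommGroup U] [Module k U] [DistribMulAction G U]
    [SMulCommClass G k U] (h : IsIrreducibleRep k G U) : Module.Finite k U := by
  obtain ⟨hn, h⟩ := h
  obtain ⟨v, hv⟩ := exists_ne (0 : U)
  have hst : ∀ g : G, ∀ x ∈ Submodule.span k (Set.range fun g : G => g • v),
      g • x ∈ Submodule.span k (Set.range fun g : G => g • v) := by
    intro g x hx
    induction hx using Submodule.span_induction with
    | mem x hx =>
      obtain ⟨a, rfl⟩ := hx
      exact Submodule.subset_span ⟨g * a, by simp [mul_smul]⟩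
    | zero => simp
    | add x y _ _ hx hy => rw [smul_add]; exact Submodule.add_mem _ hx hy
    | smul a x _ hx => rw [smul_comm g]; exact Submodule.smul_mem _ _ hx
  rcases h _ hst with h | h
  · exfalso
    apply hv
    have : v ∈ Submodule.span k (Set.range fun g : G => g • v) :=
      Submodule.subset_span ⟨1, by simp⟩
    rw [h] at this
    simpa using this
  · exact ⟨⟨(Set.finite_range fun g : G => g • v).toFinset, by simpa using h⟩⟩

theorem schur_zero (U U' : Type) [AddCommGroup U] [Module k U] [DistribMulAction G U]
    [SMulCommClass G k U] [AddCommGroup U'] [Module k U'] [DistribMulAction G U']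
    [SMulCommClass G k U'] (h : IsIrreducibleRep k G U) (h' : IsIrreducibleRep k G U')
    (hne : ¬ IsRepIso k G U U') (f : U →ₗ[k] U') (hf : ∀ (g : G) x, f (g • x) = g • f x) :
    f = 0 := by
  by_contra h0
  apply hne
  have hker : LinearMap.ker f = ⊥ := by
    rcases h.2 (LinearMap.ker f) (by
      intro g x hx
      rw [LinearMap.mem_ker] at hx ⊢
      rw [hf, hx, smul_zero]) with h1 | h1
    · exact h1
    · exact absurd (LinearMap.ker_eq_top.1 h1) h0
  have hran : LinearMap.range f = ⊤ := by
    rcases h'.2 (LinearMap.range f) (by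
      rintro g _ ⟨x, rfl⟩
      exact ⟨g • x, hf g x⟩) with h1 | h1
    · exact absurd (LinearMap.range_eq_bot.1 h1) h0
    · exact h1
  exact ⟨LinearEquiv.ofBijective f ⟨LinearMap.ker_eq_bot.1 hker, LinearMap.range_eq_top.1 hran⟩,
    hf⟩

theorem schur_scalar [IsAlgClosed k] (U : Type) [AddCommGroup U] [Module k U]
    [DistribMulAction G U] [SMulCommClass G k U] (h : IsIrreducibleRep k G U)
    (f : U →ₗ[k] U) (hf : ∀ (g : G) x, f (g • x) = g • f x) :
    ∃ c : k, ∀ x, f x = c • x := by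
  have := irr_finite U h
  have := h.1
  obtain ⟨c, hc⟩ := Module.End.exists_eigenvalue f
  refine ⟨c, fun x => ?_⟩
  rcases h.2 (Module.End.eigenspace f c) (by
      intro g x hx
      rw [Module.End.mem_eigenspace_iff] at hx ⊢
      rw [hf, hx, smul_comm]) with h1 | h1
  · exact absurd h1 hc
  · have : x ∈ Module.End.eigenspace f c := by rw [h1]; trivial
    exact Module.End.mem_eigenspace_iff.1 this

theorem sum_sq_ge (p : ℕ) [Fact p.Prime] [CharP k p] (hord : ¬ p ∣ Fintype.card G) {ι : Type}
    [Fintype ι]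
    (W : ι → Type) [∀ i, AddCommGroup (W i)] [∀ i, Module k (W i)]
    [∀ i, DistribMulAction G (W i)] [∀ i, SMulCommClass G k (W i)]
    (hirr : ∀ i, IsIrreducibleRep k G (W i))
    (hcomplete : ∀ (P : Type) [AddCommGroup P] [Module k P] [DistribMulAction G P]
      [SMulCommClass G k P], IsIrreducibleRep k G P → ∃ i, IsRepIso k G P (W i)) :
    Fintype.card G ≤ ∑ i, Module.finrank k (W i) ^ 2 := by
  classical
  have : ∀ i, Module.Finite k (W i) := fun i => irr_finite _ (hirr i)
  let Λ : (G → k) →ₗ[k] (∀ i, W i →ₗ[k] W i) :=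
    { toFun := fun a i => ∑ g, a g • DistribSMul.toLinearMap k (W i) g
      map_add' := by intro a b; ext i x; simp [add_smul, Finset.sum_add_distrib]
      map_smul' := by intro c a; ext i x; simp [mul_smul, Finset.smul_sum] }
  have hinj : Function.Injective Λ := by
    rw [injective_iff_map_eq_zero]
    intro a ha
    have hNZ : NeZero (Nat.card G : k) := by
      constructor
      rw [Nat.card_eq_fintype_card, Ne, CharP.cast_eq_zero_iff k p]
      exact hord
    let x : MonoidAlgebra k G := ∑ g, a g • MonoidAlgebra.of k G g
    have hx : x = 0 := by
      have hj := IsSemisimpleRing.jacobson_eq_bot (MonoidAlgebra k G)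
      rw [← Ideal.mem_bot, ← hj, Ring.jacobson, Module.jacobson, Submodule.mem_sInf]
      intro I hI
      let P := MonoidAlgebra k G ⧸ I
      have hsimple : IsSimpleModule (MonoidAlgebra k G) P := isSimpleModule_iff_isCoatom.2 hI
      let _ : DistribMulAction G P := DistribMulAction.compHom P (MonoidAlgebra.of k G)
      have hsm : ∀ (g : G) (y : P), g • y = MonoidAlgebra.of k G g • y := fun _ _ => rfl
      have : SMulCommClass G k P := ⟨by
        intro g c y
        rw [hsm, hsm]
        rw [← algebraMap_smul (MonoidAlgebra k G) c y,
          ← algebraMap_smul (MonoidAlgebra k G) c (MonoidAlgebra.of k G g • y),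
          smul_smul, smul_smul, Algebra.commutes]⟩
      have hP : IsIrreducibleRep k G P := by
        refine ⟨IsSimpleModule.nontrivial (MonoidAlgebra k G) P, ?_⟩
        intro N hN
        let N' : Submodule (MonoidAlgebra k G) P :=
          { carrier := N
            add_mem' := fun h1 h2 => N.add_mem h1 h2
            zero_mem' := N.zero_mem
            smul_mem' := by
              intro r y hy
              induction r using MonoidAlgebra.induction_on with
              | of g => exact hN g y hy
              | add r r' h1 h2 => rw [add_smul]; exact N.add_mem h1 h2
              | smul c r h1 => rw [smul_assoc]; exact N.smul_mem c h1 }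
        rcases eq_bot_or_eq_top N' with h | h
        · left
          ext y
          have : y ∈ N' ↔ y ∈ (⊥ : Submodule (MonoidAlgebra k G) P) := by rw [h]
          exact this
        · right
          ext y
          have : y ∈ N' ↔ y ∈ (⊤ : Submodule (MonoidAlgebra k G) P) := by rw [h]
          exact this
      obtain ⟨i, θ, hθ⟩ := hcomplete P hP
      have h1 : ∑ g, a g • (g • (Submodule.Quotient.mk 1 : P)) = 0 := by
        apply θ.injective
        rw [map_sum, map_zero]
        simp only [map_smul, hθ]
        have := LinearMap.congr_fun (congrFun ha i) (θ (Submodule.Quotient.mk 1))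
        simpa [Λ] using this
      have h2 : x • (Submodule.Quotient.mk 1 : P) = 0 := by
        rw [← h1]
        simp only [x, Finset.sum_smul, smul_assoc, hsm]
      rw [← Submodule.Quotient.mk_smul, Submodule.Quotient.mk_eq_zero] at h2
      simpa using h2
    ext g
    have := congrArg (fun y : MonoidAlgebra k G => y.coeff g) hx
    simpa [x, Finsupp.single_apply] using this
  have := LinearMap.finrank_le_finrank_of_injective hinj
  rw [Module.finrank_fintype_fun_eq_card, Module.finrank_pi_fintype] at this
  simpa [Module.finrank_linearMap, sq] using this

end PartFive



section PartSix

variable {k : Type} [Field k]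

theorem finrank_le_semi [IsAlgClosed k] (q : ℕ) (hq : 0 < q) (M M' : Type) [AddCommGroup M]
    [Module k M] [AddCommGroup M'] [Module k M'] [Module.Finite k M'] (j : M →+ M')
    (hj : Function.Injective j) (h : ∀ (c : k) m, j (c • m) = c ^ q • j m) :
    Module.finrank k M ≤ Module.finrank k M' := by
  have h1 := rank_le_of_surjective_injective (fun c : k => c ^ q) j
    (fun c => IsAlgClosed.exists_pow_nat_eq c hq) hj h
  exact Cardinal.toNat_le_toNat h1 (Module.rank_lt_aleph0 k M')

theorem finrank_le_semi' [IsAlgClosed k] (p : ℕ) [Fact p.Prime] [CharP k p] (e : ℕ) (M M' : Type)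
    [AddCommGroup M]
    [Module k M] [AddCommGroup M'] [Module k M'] [Module.Finite k M'] (j : M →+ M')
    (hj : Function.Injective j) (h : ∀ (c : k) m, j (c ^ p ^ e • m) = c • j m) :
    Module.finrank k M ≤ Module.finrank k M' := by
  have hroot : ∀ c : k, ∃ z : k, z ^ p ^ e = c := fun c =>
    IsAlgClosed.exists_pow_nat_eq c (pow_pos (Fact.out : p.Prime).pos e)
  choose ρ hρ using hroot
  have hinj : ∀ x y : k, x ^ p ^ e = y ^ p ^ e → x = y := by
    intro x y hxy
    rw [← sub_eq_zero, ← sub_pow_char_pow] at hxy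
    exact sub_eq_zero.1 (eq_zero_of_pow_eq_zero hxy)
  have h1 := rank_le_of_surjective_injective ρ j
    (fun c => ⟨c ^ p ^ e, hinj _ _ (hρ _)⟩) hj (fun c m => by
      rw [← h, hρ])
  exact Cardinal.toNat_le_toNat h1 (Module.rank_lt_aleph0 k M')

variable {d : ℕ} {U : Type} [AddCommGroup U] [Module k U] [Module.Finite k U]

theorem psi_ker {ι : Type} (W : ι → Type) [∀ i, AddCommGroup (W i)]
    [∀ i, Module k (W i)] (m : ι → ℕ) (q : ℕ)
    (ψ : (MvPolynomial (Fin d) k ⊗[k] U) ≃+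
        (∀ j, Fin (m j) → MvPolynomial (Fin d) k ⊗[k] (W j)))
    (hψ : ∀ (s : MvPolynomial (Fin d) k) a, ψ (s ^ q • a) = s • ψ a)
    (x : MvPolynomial (Fin d) k ⊗[k] U) :
    (∃ y : Fin d → MvPolynomial (Fin d) k ⊗[k] U,
      x = ∑ l, (X l : MvPolynomial (Fin d) k) ^ q • y l) ↔
    ∀ j t, evz k d (W j) (ψ x j t) = 0 := by
  constructor
  · rintro ⟨y, rfl⟩ j t
    rw [evz_eq_zero]
    refine ⟨fun l => ψ (y l) j t, ?_⟩
    rw [map_sum]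
    simp only [hψ, Finset.sum_apply, Pi.smul_apply]
  · intro h
    have h1 := fun j t => (evz_eq_zero _).1 (h j t)
    choose y hy using h1
    refine ⟨fun l => ψ.symm fun j t => y j t l, ?_⟩
    apply ψ.injective
    rw [map_sum]
    simp only [hψ, ψ.apply_symm_apply]
    ext1 j
    ext1 t
    rw [hy j t]
    simp only [Finset.sum_apply, Pi.smul_apply]

theorem aux_upper [IsAlgClosed k] {ι : Type} [Fintype ι] (W : ι → Type)
    [∀ i, AddCommGroup (W i)]
    [∀ i, Module k (W i)] [∀ i, Module.Finite k (W i)] (m : ι → ℕ) (q : ℕ) (hq : 0 < q)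
    (ψ : (MvPolynomial (Fin d) k ⊗[k] U) ≃+
        (∀ j, Fin (m j) → MvPolynomial (Fin d) k ⊗[k] (W j)))
    (hψ : ∀ (s : MvPolynomial (Fin d) k) a, ψ (s ^ q • a) = s • ψ a) :
    ∑ j, m j * Module.finrank k (W j) ≤ Module.finrank k U * q ^ d := by
  have hψ' : ∀ (s : MvPolynomial (Fin d) k) b, ψ.symm (s • b) = s ^ q • ψ.symm b := by
    intro s b
    apply ψ.injective
    rw [hψ, ψ.apply_symm_apply, ψ.apply_symm_apply]
  let fs : (Fin d → Fin q) → (Fin d →₀ ℕ) := fun b =>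
    Finsupp.equivFunOnFinite.symm fun l => (b l : ℕ)
  let Ψ : (∀ j, Fin (m j) → W j) →+
      (Fin (Module.finrank k U) → (Fin d → Fin q) → k) :=
    { toFun := fun a u b => coeff (fs b) ((bN k d U).coord u
        (ψ.symm fun j t => (1 : MvPolynomial (Fin d) k) ⊗ₜ[k] a j t))
      map_zero' := by
        ext u b
        have : (fun j t => (1 : MvPolynomial (Fin d) k) ⊗ₜ[k]
          (0 : ∀ j, Fin (m j) → W j) j t) = 0 := by
          ext1 j
          ext1 t
          simp
        rw [this]
        simp
      map_add' := by
        intro x y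
        ext u b
        have : (fun j t => (1 : MvPolynomial (Fin d) k) ⊗ₜ[k] (x + y) j t) =
            (fun j t => (1 : MvPolynomial (Fin d) k) ⊗ₜ[k] x j t) +
            (fun j t => (1 : MvPolynomial (Fin d) k) ⊗ₜ[k] y j t) := by
          ext1 j
          ext1 t
          simp [TensorProduct.tmul_add]
        rw [this]
        simp only [map_add, Pi.add_apply, coeff_add] }
  have h1 : Module.finrank k (∀ j, Fin (m j) → W j) ≤
      Module.finrank k (Fin (Module.finrank k U) → (Fin d → Fin q) → k) := by
    refine finrank_le_semi q hq _ _ Ψ ?_ ?_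
    · rw [injective_iff_map_eq_zero]
      intro a ha
      have h2 := (psi_ker W m q ψ hψ (ψ.symm fun j t =>
        (1 : MvPolynomial (Fin d) k) ⊗ₜ[k] a j t)).1 ((inM_iff q _).2 (by
          intro u b hb
          have := congrFun (congrFun ha u) (fun l => ⟨b l, hb l⟩)
          have hfs : fs (fun l => ⟨b l, hb l⟩) = b := by ext l; simp [fs]
          change coeff (fs (fun l => ⟨b l, hb l⟩)) _ = 0 at this
          rwa [hfs] at this))
      ext1 j
      ext1 t
      have h3 := h2 j t
      rw [ψ.apply_symm_apply, evz_tmul] at h3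
      simpa using h3
    · intro c a
      ext u b
      have : (fun j t => (1 : MvPolynomial (Fin d) k) ⊗ₜ[k] (c • a) j t) =
            (C c : MvPolynomial (Fin d) k) •
            (fun j t => (1 : MvPolynomial (Fin d) k) ⊗ₜ[k] a j t) := by
          ext1 j
          ext1 t
          simp only [Pi.smul_apply, TensorProduct.smul_tmul', smul_eq_mul,
            TensorProduct.tmul_smul]
          rw [MvPolynomial.smul_eq_C_mul]
      change coeff (fs b) ((bN k d U).coord u
        (ψ.symm fun j t => (1 : MvPolynomial (Fin d) k) ⊗ₜ[k] (c • a) j t)) = _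
      rw [this, hψ', map_smul, smul_eq_mul, ← C_pow, coeff_C_mul]
      rfl
  simpa [Module.finrank_pi_fintype] using h1

variable {G : Type} [Group G] [Fintype G]
variable [MulSemiringAction G (MvPolynomial (Fin d) k)]
variable [SMulCommClass G k (MvPolynomial (Fin d) k)]
variable [DistribMulAction G U] [SMulCommClass G k U]

/-- The polynomial with given coefficients on a box. -/
noncomputable def boxPoly (N : Fin d → ℕ) : ((∀ l, Fin (N l)) → k) →+ MvPolynomial (Fin d) k where
  toFun ε := ∑ b, monomial (Finsupp.equivFunOnFinite.symm fun l => (b l : ℕ)) (ε b)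
  map_zero' := by simp
  map_add' := by intro x y; simp [Finset.sum_add_distrib]

theorem boxPoly_smul (N : Fin d → ℕ) (c : k) (ε : (∀ l, Fin (N l)) → k) :
    boxPoly N (c • ε) = C c * boxPoly N ε := by
  simp [boxPoly, Finset.mul_sum, C_mul_monomial]

theorem boxPoly_inj (N : Fin d → ℕ) (ε : (∀ l, Fin (N l)) → k) (h : boxPoly N ε = 0) : ε = 0 := by
  classical
  ext b
  have := congrArg (coeff (Finsupp.equivFunOnFinite.symm fun l => (b l : ℕ))) h
  simp only [boxPoly, AddMonoidHom.coe_mk, ZeroHom.coe_mk, coeff_sum, coeff_monomial,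
    EmbeddingLike.apply_eq_iff_eq, coeff_zero] at this
  rw [Finset.sum_eq_single b] at this
  · simpa using this
  · intro b' _ hb'
    rw [if_neg]
    intro h
    apply hb'
    ext l
    exact congrFun h l
  · simp

theorem boxPoly_support (N : Fin d → ℕ) (ε : (∀ l, Fin (N l)) → k) (b : Fin d →₀ ℕ)
    (hb : b ∈ (boxPoly N ε).support) (l : Fin d) : b l < N l := by
  classical
  by_contra hcon
  apply mem_support_iff.1 hb
  simp only [boxPoly, AddMonoidHom.coe_mk, ZeroHom.coe_mk, coeff_sum, coeff_monomial]
  refine Finset.sum_eq_zero fun b' _ => ?_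
  rw [if_neg]
  rintro rfl
  exact hcon (b' l).2

end PartSix



section PartSeven

variable {k : Type} [Field k] {d : ℕ} {U : Type} [AddCommGroup U] [Module k U] [Module.Finite k U]
variable {G : Type} [Group G] [Fintype G]
variable [MulSemiringAction G (MvPolynomial (Fin d) k)]
variable [SMulCommClass G k (MvPolynomial (Fin d) k)]
variable [DistribMulAction G U] [SMulCommClass G k U]

theorem aux_lower [IsAlgClosed k] (p : ℕ) [Fact p.Prime] [CharP k p] [DecidableEq G]
    (hlin : ∀ (g : G) (j : Fin d),
      g • (X j : MvPolynomial (Fin d) k) ∈ Submodule.span k (Set.range X))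
    (t t' : G → MvPolynomial (Fin d) k) (c : MvPolynomial (Fin d) k)
    (htt : ∀ g : G, ∑ i, t i * (g • t' i) = if g = 1 then c else 0)
    (a : Fin d → ℕ)
    (ha : ∀ (q : ℕ) (u : MvPolynomial (Fin d) k),
      (∀ b ∈ u.support, ∀ l, b l < q - a l) →
      (∀ b : Fin d →₀ ℕ, (∀ l, b l < q) → coeff b (c * u) = 0) → u = 0)
    {ι : Type} (W : ι → Type) [∀ i, AddCommGroup (W i)] [∀ i, Module k (W i)]
    [∀ i, DistribMulAction G (W i)] [∀ i, SMulCommClass G k (W i)]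
    [∀ i, Module.Finite k (W i)]
    (hirr : ∀ i, IsIrreducibleRep k G (W i))
    (hdist : ∀ i j, i ≠ j → ¬ IsRepIso k G (W i) (W j))
    (m : ι → ℕ) (e : ℕ)
    (ψ : (MvPolynomial (Fin d) k ⊗[k] U) ≃+
        (∀ j, Fin (m j) → MvPolynomial (Fin d) k ⊗[k] (W j)))
    (hψ : ∀ (s : MvPolynomial (Fin d) k) a, ψ (s ^ p ^ e • a) = s • ψ a)
    (hψG : ∀ (g : G) a j t, ψ (diagAction k d G U g a) j t = diagAction k d G (W j) g (ψ a j t))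
    (j : ι) :
    Module.finrank k (W j) * (Module.finrank k U * ∏ l, (p ^ e - a l)) ≤
      Fintype.card G * m j := by
  classical
  let S := MvPolynomial (Fin d) k
  let N := S ⊗[k] U
  let bW := Module.finBasis k (W j)
  let N0 : Fin d → ℕ := fun l => p ^ e - a l
  let E := Fin (Module.finrank k (W j)) → Fin (Module.finrank k U) → ((∀ l, Fin (N0 l)) → k)
  let vec : (Fin (Module.finrank k U) → ((∀ l, Fin (N0 l)) → k)) →+ N :=
    { toFun := fun ε => ∑ u, boxPoly N0 (ε u) • bN k d U u
      map_zero' := by simp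
      map_add' := by intro x y; simp [add_smul, Finset.sum_add_distrib] }
  have hvec_smul : ∀ (z : k) ε, vec (z • ε) = (C z : S) • vec ε := by
    intro z ε
    change ∑ u, boxPoly N0 (z • ε u) • bN k d U u = (C z : S) • ∑ u, boxPoly N0 (ε u) • bN k d U u
    simp only [boxPoly_smul, Finset.smul_sum, smul_smul]
  have hvec_coord : ∀ ε u, (bN k d U).coord u (vec ε) = boxPoly N0 (ε u) := by
    intro ε u
    change (bN k d U).repr (∑ u, boxPoly N0 (ε u) • bN k d U u) u = _
    rw [(bN k d U).repr_sum_self]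
  -- semilinear maps
  let β : E → W j → N := fun ε v => ∑ r, (C (bW.coord r v) : S) ^ p ^ e • vec (ε r)
  have hβ_add : ∀ ε v v', β ε (v + v') = β ε v + β ε v' := by
    intro ε v v'
    simp only [β, map_add, add_pow_char_pow, add_smul, Finset.sum_add_distrib]
  have hβ_smul : ∀ ε (z : k) v, β ε (z • v) = (C z : S) ^ p ^ e • β ε v := by
    intro ε z v
    simp only [β, map_smul, smul_eq_mul, C_mul, mul_pow, Finset.smul_sum, smul_smul]
  have hEadd : ∀ (ε ε' : E) r, (ε + ε') r = ε r + ε' r := fun _ _ _ => rfl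
  have hEsmul : ∀ (z : k) (ε : E) r, (z • ε) r = z • ε r := fun _ _ _ => rfl
  have hβ_add' : ∀ ε ε' v, β (ε + ε') v = β ε v + β ε' v := by
    intro ε ε' v
    simp only [β, hEadd, map_add, smul_add, Finset.sum_add_distrib]
  have hβ_smul' : ∀ ε (z : k) v, β (z ^ p ^ e • ε) v = (C z : S) ^ p ^ e • β ε v := by
    intro ε z v
    simp only [β, hEsmul, hvec_smul, Finset.smul_sum, C_pow]
    refine Finset.sum_congr rfl fun r _ => ?_
    rw [smul_comm]
  have hβ_basis : ∀ ε r, β ε (bW r) = vec (ε r) := by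
    intro ε r
    simp only [β]
    rw [Finset.sum_eq_single r]
    · simp
    · intro r' _ hr'
      have : bW.coord r' (bW r) = 0 := by
        simp [Finsupp.single_apply, hr'.symm]
      rw [this, C_0, zero_pow (pow_ne_zero _ (Fact.out : p.Prime).ne_zero), zero_smul]
    · simp
  let T : G → E → W j → N := fun i ε v => ∑ g : G, diagAction k d G U g (t' i • β ε (g⁻¹ • v))
  have hT_add : ∀ i ε v v', T i ε (v + v') = T i ε v + T i ε v' := by
    intro i ε v v'
    simp only [T, smul_add, hβ_add, map_add, Finset.sum_add_distrib]
  have hdC : ∀ (g : G) (z : k) (x : N), diagAction k d G U g ((C z : S) ^ p ^ e • x) =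
      (C z : S) ^ p ^ e • diagAction k d G U g x := by
    intro g z x
    rw [diagAction_smul, smul_pow', aux_smul_C]
  have hT_smul : ∀ i ε (z : k) v, T i ε (z • v) = (C z : S) ^ p ^ e • T i ε v := by
    intro i ε z v
    simp only [T, Finset.smul_sum]
    refine Finset.sum_congr rfl fun g _ => ?_
    rw [smul_comm g⁻¹, hβ_smul, smul_comm (t' i), hdC]
  have hT_add' : ∀ i ε ε' v, T i (ε + ε') v = T i ε v + T i ε' v := by
    intro i ε ε' v
    simp only [T, hβ_add', smul_add, map_add, Finset.sum_add_distrib]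
  have hT_smul' : ∀ i ε (z : k) v, T i (z ^ p ^ e • ε) v = (C z : S) ^ p ^ e • T i ε v := by
    intro i ε z v
    simp only [T, Finset.smul_sum]
    refine Finset.sum_congr rfl fun g _ => ?_
    rw [hβ_smul', smul_comm (t' i), hdC]
  have hT_G : ∀ i ε (h : G) v, T i ε (h • v) = diagAction k d G U h (T i ε v) := by
    intro i ε h v
    simp only [T, map_sum, ← diag_mul]
    rw [← Equiv.sum_comp (Equiv.mulLeft h)]
    refine Finset.sum_congr rfl fun g _ => ?_
    simp [smul_smul, mul_assoc]
  have hcβ : ∀ ε v, c • β ε v = ∑ i, t i • T i ε v := by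
    intro ε v
    simp only [T, Finset.smul_sum]
    rw [Finset.sum_comm]
    have : ∀ g : G, ∑ i, t i • diagAction k d G U g (t' i • β ε (g⁻¹ • v)) =
        (if g = 1 then c else 0) • diagAction k d G U g (β ε (g⁻¹ • v)) := by
      intro g
      rw [← htt g, Finset.sum_smul]
      refine Finset.sum_congr rfl fun i _ => ?_
      rw [diagAction_smul, smul_smul]
    simp only [this]
    rw [Finset.sum_eq_single 1]
    · rw [if_pos rfl, diag_one]; simp
    · intro g _ hg
      rw [if_neg hg, zero_smul]
    · simp
  -- reduction
  let h : G → E → ∀ l, Fin (m l) → (W j →ₗ[k] W l) := fun i ε l r =>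
    { toFun := fun v => evz k d (W l) (ψ (T i ε v) l r)
      map_add' := by intro v v'; simp only [hT_add, map_add, Pi.add_apply]
      map_smul' := by
        intro z v
        simp only [hT_smul, hψ, Pi.smul_apply, evz_smul]
        simp }
  have hh_G : ∀ i ε l r (g : G) v, h i ε l r (g • v) = g • h i ε l r v := by
    intro i ε l r g v
    change evz k d (W l) (ψ (T i ε (g • v)) l r) = g • evz k d (W l) (ψ (T i ε v) l r)
    rw [hT_G, hψG, evz_diag hlin]
  obtain ⟨v0, hv0⟩ := @exists_ne _ (hirr j).1 (0 : W j)
  obtain ⟨ℓ, hℓ⟩ : ∃ ℓ : W j →ₗ[k] k, ℓ v0 ≠ 0 := by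
    by_contra! hcon
    exact hv0 ((Module.forall_dual_apply_eq_zero_iff k v0).1 hcon)
  let Φ : E →+ (G → Fin (m j) → k) :=
    { toFun := fun ε i r => ℓ (h i ε j r v0)
      map_zero' := by
        ext i r
        have : T i 0 v0 = 0 := by
          have := hT_add' i 0 0 v0
          rw [add_zero] at this
          exact left_eq_add.1 this
        change ℓ (evz k d (W j) (ψ (T i 0 v0) j r)) = 0
        rw [this]
        simp
      map_add' := by
        intro ε ε'
        ext i r
        change ℓ (evz k d (W j) (ψ (T i (ε + ε') v0) j r)) =
          ℓ (evz k d (W j) (ψ (T i ε v0) j r)) + ℓ (evz k d (W j) (ψ (T i ε' v0) j r))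
        rw [hT_add', map_add, Pi.add_apply, Pi.add_apply, map_add, map_add] }
  have hfin : Module.finrank k E ≤ Module.finrank k (G → Fin (m j) → k) := by
    refine finrank_le_semi' p e _ _ Φ ?_ ?_
    · rw [injective_iff_map_eq_zero]
      intro ε hε
      have hzero : ∀ i l r, h i ε l r = 0 := by
        intro i l r
        by_cases hlj : j = l
        · subst hlj
          obtain ⟨z, hz⟩ := schur_scalar (W j) (hirr j) (h i ε j r) (hh_G i ε j r)
          have h1 : ℓ (h i ε j r v0) = 0 := congrFun (congrFun hε i) r
          rw [hz, map_smul, smul_eq_mul, mul_eq_zero] at h1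
          have h2 : z = 0 := h1.resolve_right hℓ
          ext v
          rw [hz, h2]
          simp
        · exact schur_zero _ _ (hirr j) (hirr l) (hdist j l hlj) _ (hh_G i ε l r)
      have hTin : ∀ i v, ∃ y : Fin d → N, T i ε v = ∑ l, (X l : S) ^ p ^ e • y l := by
        intro i v
        rw [psi_ker W m (p ^ e) ψ hψ]
        intro l r
        exact LinearMap.congr_fun (hzero i l r) v
      ext1 r
      ext1 u
      apply boxPoly_inj N0
      refine ha (p ^ e) _ (boxPoly_support N0 _) ?_
      have hc : ∃ y : Fin d → N, c • β ε (bW r) = ∑ l, (X l : S) ^ p ^ e • y l := by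
        choose y hy using fun i => hTin i (bW r)
        refine ⟨fun l => ∑ i, t i • y i l, ?_⟩
        rw [hcβ]
        simp only [hy, Finset.smul_sum]
        rw [Finset.sum_comm]
        refine Finset.sum_congr rfl fun l _ => Finset.sum_congr rfl fun i _ => ?_
        rw [smul_comm]
      have h3 := (inM_iff (p ^ e) _).1 hc u
      rw [hβ_basis, map_smul, hvec_coord, smul_eq_mul] at h3
      exact h3
    · intro z ε
      ext i r
      change ℓ (evz k d (W j) (ψ (T i (z ^ p ^ e • ε) v0) j r)) =
        z • ℓ (evz k d (W j) (ψ (T i ε v0) j r))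
      rw [hT_smul', hψ, Pi.smul_apply, Pi.smul_apply, evz_smul, ← map_smul]
      simp
  simpa [E, N0, Module.finrank_pi_fintype] using hfin

end PartSeven


theorem aux_limit (p d N : ℕ) (hp : 2 ≤ p) (g : ℕ) (hg : 0 < g) (a : Fin d → ℕ) (ni : ℕ)
    (w : Fin N → ℕ) (hw : ∀ j, 0 < w j) (dd : ℕ → Fin N → ℕ)
    (hlow : ∀ e j, w j * (ni * ∏ l, (p ^ e - a l)) ≤ g * dd e j)
    (hup : ∀ e, ∑ j, dd e j * w j ≤ ni * (p ^ e) ^ d)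
    (hsq : g ≤ ∑ j, w j ^ 2) (j : Fin N) :
    Filter.Tendsto (fun e : ℕ => (dd e j : ℝ) / (p : ℝ) ^ (d * e)) Filter.atTop
      (nhds ((ni : ℝ) * (w j : ℝ) / (g : ℝ))) := by
  have hp0 : (0 : ℝ) < p := by exact_mod_cast (by omega : 0 < p)
  have hp1 : (1 : ℝ) < p := by exact_mod_cast (by omega : 1 < p)
  have hg0 : (0 : ℝ) < g := by exact_mod_cast hg
  have hwj : (0 : ℝ) < w j := by exact_mod_cast hw j
  let P : ℕ → ℝ := fun e => ∏ l, ((p ^ e - a l : ℕ) : ℝ) / (p : ℝ) ^ e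
  have hpow : Filter.Tendsto (fun e : ℕ => (p : ℝ) ^ e) Filter.atTop Filter.atTop :=
    tendsto_pow_atTop_atTop_of_one_lt hp1
  have hP : Filter.Tendsto P Filter.atTop (nhds 1) := by
    have : Filter.Tendsto P Filter.atTop (nhds (∏ _l : Fin d, (1 : ℝ))) := by
      refine tendsto_finsetProd _ fun l _ => ?_
      have h1 : Filter.Tendsto (fun e : ℕ => 1 - (a l : ℝ) / (p : ℝ) ^ e) Filter.atTop
          (nhds (1 - 0)) := tendsto_const_nhds.sub (hpow.const_div_atTop _)
      rw [sub_zero] at h1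
      refine h1.congr' ?_
      filter_upwards [hpow.eventually_ge_atTop (a l : ℝ)] with e he
      have he' : a l ≤ p ^ e := by exact_mod_cast he
      rw [Nat.cast_sub he', sub_div]
      push_cast
      rw [div_self (pow_pos hp0 e).ne']
    simpa using this
  have hq : ∀ e : ℕ, (0 : ℝ) < (p : ℝ) ^ (d * e) := fun e => pow_pos hp0 _
  have hPe : ∀ e, P e * (p : ℝ) ^ (d * e) = ∏ l, ((p ^ e - a l : ℕ) : ℝ) := by
    intro e
    simp only [P, Finset.prod_div_distrib, Finset.prod_const, Finset.card_univ, Fintype.card_fin]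
    rw [mul_comm d e, pow_mul, div_mul_cancel₀]
    exact (pow_pos (pow_pos hp0 _) _).ne'
  have hPnn : ∀ e, 0 ≤ P e := fun e => Finset.prod_nonneg fun l _ => by positivity
  let x : ℕ → Fin N → ℝ := fun e j => (dd e j : ℝ) / (p : ℝ) ^ (d * e)
  have hlow' : ∀ e j, (ni : ℝ) * w j / g * P e ≤ x e j := by
    intro e j
    have h : (w j : ℝ) * (ni * ∏ l, ((p ^ e - a l : ℕ) : ℝ)) ≤ g * dd e j := by
      exact_mod_cast hlow e j
    rw [← hPe] at h
    simp only [x]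
    rw [le_div_iff₀ (hq e), div_mul_eq_mul_div, div_mul_eq_mul_div, div_le_iff₀ hg0]
    linarith
  have hup' : ∀ e, ∑ j, x e j * w j ≤ ni := by
    intro e
    have h : ∑ j, (dd e j : ℝ) * w j ≤ ni * ((p : ℝ) ^ e) ^ d := by exact_mod_cast hup e
    have : ∑ j, x e j * w j = (∑ j, (dd e j : ℝ) * w j) / (p : ℝ) ^ (d * e) := by
      rw [Finset.sum_div]
      exact Finset.sum_congr rfl fun j _ => by simp only [x]; ring
    rw [this, div_le_iff₀ (hq e), mul_comm d e, pow_mul]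
    exact h
  have hup2 : ∀ e, x e j ≤ (ni - ni / g * P e * (g - (w j : ℝ) ^ 2)) / w j := by
    intro e
    rw [le_div_iff₀ hwj]
    have h1 := hup' e
    rw [← Finset.add_sum_erase _ _ (Finset.mem_univ j)] at h1
    have h2 : ∑ l ∈ Finset.univ.erase j, (ni : ℝ) / g * P e * (w l : ℝ) ^ 2 ≤
        ∑ l ∈ Finset.univ.erase j, x e l * w l := by
      refine Finset.sum_le_sum fun l _ => ?_
      have := mul_le_mul_of_nonneg_right (hlow' e l) (Nat.cast_nonneg (α := ℝ) (w l))
      refine le_trans (le_of_eq ?_) this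
      ring
    rw [← Finset.mul_sum] at h2
    have h3 : (g : ℝ) ≤ ∑ l, (w l : ℝ) ^ 2 := by exact_mod_cast hsq
    rw [← Finset.add_sum_erase _ _ (Finset.mem_univ j)] at h3
    have h4 : (0 : ℝ) ≤ (ni : ℝ) / g * P e := mul_nonneg (by positivity) (hPnn e)
    have h5 := mul_le_mul_of_nonneg_left (sub_le_iff_le_add'.mpr h3) h4
    linarith
  have t1 : Filter.Tendsto (fun e => (ni : ℝ) * w j / g * P e) Filter.atTop
      (nhds ((ni : ℝ) * w j / g)) := by
    simpa using hP.const_mul ((ni : ℝ) * w j / g)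
  have t2 : Filter.Tendsto (fun e => (ni - ni / g * P e * (g - (w j : ℝ) ^ 2)) / w j)
      Filter.atTop (nhds ((ni : ℝ) * w j / g)) := by
    have := ((((hP.const_mul ((ni : ℝ) / g)).mul_const (g - (w j : ℝ) ^ 2)).const_sub
      (ni : ℝ)).div_const (w j : ℝ))
    convert this using 2
    field_simp
    ring
  exact tendsto_of_tendsto_of_tendsto_of_le_of_le t1 t2 (fun e => hlow' e j) hup2


theorem generalized_F_signature_with_respect_to_Mi
    (k : Type) [Field k] [IsAlgClosed k] (p : ℕ) [Fact p.Prime] [CharP k p]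
    (d n : ℕ) (G : Type) [Group G] [Fintype G]
    [MulSemiringAction G (MvPolynomial (Fin d) k)]
    [SMulCommClass G k (MvPolynomial (Fin d) k)]
    -- the order of `G` is not divisible by `p`
    (hord : ¬ p ∣ Fintype.card G)
    -- the action of `G` on `S` is induced by a linear action on `V = ⟨x_1, …, x_d⟩`
    (hlin : ∀ (g : G) (j : Fin d),
      g • (X j : MvPolynomial (Fin d) k) ∈ Submodule.span k (Set.range X))
    -- `G ⊆ GL(V)`: the action is faithful
    (hfaithful : ∀ g : G, (∀ s : MvPolynomial (Fin d) k, g • s = s) → g = 1)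
    -- `G` contains no pseudo-reflections: for `g ≠ 1`, `rank (g - 1)|_V ≠ 1`, where the image
    -- of `(g - 1)|_V` is spanned by the elements `g • x_j - x_j`
    (hps : ∀ g : G, g ≠ 1 → Module.finrank k
      (Submodule.span k (Set.range fun j : Fin d =>
        g • (X j : MvPolynomial (Fin d) k) - X j)) ≠ 1)
    -- `V_0 = k, V_1, …, V_n`: a complete set of pairwise non-isomorphic irreducible
    -- representations of `G` over `k`, with `V_0` the trivial one-dimensional representation
    (W : Fin (n + 1) → Type) [∀ i, AddCommGroup (W i)] [∀ i, Module k (W i)]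
    [∀ i, DistribMulAction G (W i)] [∀ i, SMulCommClass G k (W i)]
    (hirr : ∀ i, IsIrreducibleRep k G (W i))
    (hdist : ∀ i j, i ≠ j → ¬ IsRepIso k G (W i) (W j))
    (hcomplete : ∀ (P : Type) [AddCommGroup P] [Module k P] [DistribMulAction G P]
      [SMulCommClass G k P], IsIrreducibleRep k G P → ∃ i, IsRepIso k G P (W i))
    (htriv : Module.finrank k (W 0) = 1 ∧ ∀ (g : G) (x : W 0), g • x = x)
    (i : Fin (n + 1))
    -- `dd` gives multiplicities of a decomposition `ᵉ(M_i) ≅ ⊕_j M_j^{⊕ dd e j}` as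
    -- `R`-modules, where `ᵉ(M_i)` is `M_i` with the `R`-action `r · x = r^{p^e} • x`
    (dd : ℕ → Fin (n + 1) → ℕ)
    (hdd : ∀ e : ℕ,
      ∃ φ : invariantsTensor k d G (W i) ≃+
        (∀ j : Fin (n + 1), Fin (dd e j) → invariantsTensor k d G (W j)),
      ∀ (r : invariantSubalgebra k d G) (x : invariantsTensor k d G (W i)),
        φ (r ^ p ^ e • x) = r • φ x) :
    -- conclusion: `dd e j / p^{d e}` converges to `(dim_k V_i)(dim_k V_j) / |G|`
    ∀ j : Fin (n + 1), Filter.Tendsto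
      (fun e : ℕ => (dd e j : ℝ) / (p : ℝ) ^ (d * e)) Filter.atTop
      (nhds ((Module.finrank k (W i) : ℝ) * (Module.finrank k (W j) : ℝ) /
        (Fintype.card G : ℝ))) := by
  classical
  intro j
  have hfin : ∀ i, Module.Finite k (W i) := fun i => irr_finite _ (hirr i)
  have hpr := aux_prime_not hlin hfaithful hps
  obtain ⟨t, t', c, hc, htt⟩ := aux_dual p hfaithful
  obtain ⟨a, ha⟩ := aux_lead c hc
  have hpp : p.Prime := Fact.out
  refine aux_limit p d (n + 1) hpp.two_le (Fintype.card G) Fintype.card_pos a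
    (Module.finrank k (W i)) (fun j => Module.finrank k (W j)) ?_ dd ?_ ?_
    (sum_sq_ge p hord W hirr hcomplete) j
  · intro j
    have := (hirr j).1
    exact Module.finrank_pos
  · intro e j
    obtain ⟨φ, hφ⟩ := hdd e
    obtain ⟨ψ, hψ, hψG⟩ := aux_psi p hfaithful hpr W (dd e) e φ hφ
    exact aux_lower p hlin t t' c htt a ha W hirr hdist (dd e) e ψ hψ hψG j
  · intro e
    obtain ⟨φ, hφ⟩ := hdd e
    obtain ⟨ψ, hψ, hψG⟩ := aux_psi p hfaithful hpr W (dd e) e φ hφ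
    exact aux_upper W (dd e) (p ^ e) (pow_pos hpp.pos e) ψ hψ
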